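/- Let s > 1 and 0 < α < 1, and for m ∈ ℤ and t ≥ 0 define f_m(t) = (1/2π) ∫_{-π}^{π} e^{-i k m} E_α(-t^α · l_s(k)) dk. Then: (i) f_m(0) = 1 if m = 0 and f_m(0) = 0 otherwise; (ii) for each m, t ↦ f_m(t) is differentiable on (0,∞); and (iii) for every m ∈ ℤ and t > 0, the Caputo fractional derivative satisfies D^α f_m(t) = -∑_{n ≠ m} (f_m(t) - f_n(t)) / |m-n|^s, the series converging absolutely. That is, f is the fundamental solution of the generalized diffusion equation D^α f(t) = -L̃(s) f(t) on the infinite path graph with initial condition f_n(0) = δ_{n0}. -/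

import Mathlib

open Complex Real

/-- The Mittag-Leffler function `E_α(x) = ∑_{j=0}^∞ x^j / Γ(α j + 1)`. -/
noncomputable def mittagLeffler (α x : ℝ) : ℝ :=
  ∑' j : ℕ, x ^ j / Real.Gamma (α * j + 1)

/-- The Caputo fractional derivative of a complex-valued function of `t > 0`. -/
noncomputable def caputoDerivC (α : ℝ) (y : ℝ → ℂ) (t : ℝ) : ℂ :=
  ((1 / Real.Gamma (1 - α) : ℝ) : ℂ) *
    ∫ τ in (0:ℝ)..t, deriv y τ * (((t - τ) ^ (-α) : ℝ) : ℂ)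

/-- `l_s(k) = 2 ∑_{d=1}^∞ d^{-s} (1 - cos(dk))`. -/
noncomputable def lsFun (s k : ℝ) : ℝ :=
  2 * ∑' d : ℕ+, (d : ℝ) ^ (-s) * (1 - Real.cos (d * k))

/-- The fundamental solution of the GDE on the infinite path graph:
`f_m(t) = (1/2π) ∫_{-π}^{π} e^{-ikm} E_α(-tᵅ l_s(k)) dk`. -/
noncomputable def fundSol (α s : ℝ) (m : ℤ) (t : ℝ) : ℂ :=
  (1 / (2 * (π : ℂ))) *
    ∫ k in (-π)..π, Complex.exp (-Complex.I * k * m) *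
      ((mittagLeffler α (-(t ^ α) * lsFun s k) : ℝ) : ℂ)

open MeasureTheory Set in
lemma gamma_lb (R y : ℝ) (hR : 0 < R) (hy : 0 ≤ y) :
    R ^ y * Real.exp (-R) ≤ Real.Gamma (y + 1) := by
  rw [Real.Gamma_eq_integral (by linarith)]
  have hint := Real.GammaIntegral_convergent (s := y + 1) (by linarith)
  have hsub : Ioi R ⊆ Ioi (0:ℝ) := Ioi_subset_Ioi hR.le
  calc R ^ y * Real.exp (-R) = ∫ x in Ioi R, R ^ y * Real.exp (-x) := by
        rw [integral_const_mul, integral_exp_neg_Ioi]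
    _ ≤ ∫ x in Ioi R, Real.exp (-x) * x ^ (y + 1 - 1) := by
        apply setIntegral_mono_on _ (hint.mono_set hsub) measurableSet_Ioi
        · intro x hx
          have hx' : R < x := hx
          rw [mul_comm, add_sub_cancel_right]
          have := Real.rpow_le_rpow hR.le hx'.le hy
          gcongr
        · exact (integrableOn_exp_neg_Ioi R).const_mul _
    _ ≤ _ := by
        apply setIntegral_mono_set hint _ hsub.eventuallyLE
        filter_upwards [ae_restrict_mem measurableSet_Ioi] with x hx
        have hx' : 0 < x := hx
        simp only [Pi.zero_apply]
        positivity

lemma gpos {α : ℝ} (hα : 0 < α) (j : ℕ) : 0 < Real.Gamma (α * j + 1) :=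
  Real.Gamma_pos_of_pos (by positivity)

lemma ml_summable {α : ℝ} (hα : 0 < α) (x : ℝ) (hx : 0 ≤ x) :
    Summable (fun j : ℕ => x ^ j / Real.Gamma (α * j + 1)) := by
  set R : ℝ := (2 * x + 1) ^ (1 / α) with hR
  have hRp : 0 < R := by positivity
  have hRα : R ^ α = 2 * x + 1 := by
    rw [hR, ← Real.rpow_mul (by positivity)]
    field_simp
    simp
  have hg : Summable (fun j : ℕ => Real.exp R * (x / (2 * x + 1)) ^ j) := by
    apply Summable.mul_left
    apply summable_geometric_of_lt_one (by positivity)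
    rw [div_lt_one (by positivity)]; linarith
  refine Summable.of_nonneg_of_le (fun j => ?_) (fun j => ?_) hg
  · have := gpos hα j
    positivity
  · have h1 := gamma_lb R (α * j) hRp (by positivity)
    rw [Real.rpow_mul hRp.le, hRα, Real.rpow_natCast] at h1
    have h2 : 0 < (2 * x + 1) ^ j * Real.exp (-R) := by positivity
    calc x ^ j / Real.Gamma (α * j + 1) ≤ x ^ j / ((2 * x + 1) ^ j * Real.exp (-R)) := by gcongr
      _ = _ := by
        rw [div_pow, Real.exp_neg]
        field_simp

lemma term_deriv {α : ℝ} (j : ℕ) (a : ℂ) {t : ℝ} (ht : 0 < t) :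
    HasDerivAt (fun t : ℝ => a * ((t ^ (α * j) / Real.Gamma (α * j + 1) : ℝ) : ℂ))
      (a * ((α * j * t ^ (α * j - 1) / Real.Gamma (α * j + 1) : ℝ) : ℂ)) t := by
  apply HasDerivAt.const_mul
  apply HasDerivAt.ofReal_comp
  exact (Real.hasDerivAt_rpow_const (Or.inl ht.ne')).div_const _

lemma F_summable {α : ℝ} (hα : 0 < α) (a : ℕ → ℂ) (C M : ℝ) (hM : 0 ≤ M)
    (ha : ∀ j, ‖a j‖ ≤ C * M ^ j) {t : ℝ} (ht : 0 ≤ t) :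
    Summable (fun j : ℕ => ‖a j * ((t ^ (α * j) / Real.Gamma (α * j + 1) : ℝ) : ℂ)‖) := by
  refine Summable.of_nonneg_of_le (fun j => norm_nonneg _) (fun j => ?_)
    ((ml_summable hα (M * t ^ α) (by positivity)).mul_left C)
  have := gpos hα j
  rw [norm_mul, Complex.norm_real, Real.norm_of_nonneg (by positivity), Real.rpow_mul ht,
    Real.rpow_natCast, mul_pow]
  calc _ ≤ C * M ^ j * ((t ^ α) ^ j / Real.Gamma (α * j + 1)) := by gcongr; exact ha j
    _ = _ := by ring

lemma F_deriv {α : ℝ} (hα : 0 < α) (a : ℕ → ℂ) (C M : ℝ) (hM : 0 ≤ M)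
    (ha : ∀ j, ‖a j‖ ≤ C * M ^ j) {t : ℝ} (ht : 0 < t) :
    HasDerivAt (fun t : ℝ => ∑' j : ℕ, a j * ((t ^ (α * j) / Real.Gamma (α * j + 1) : ℝ) : ℂ))
      (∑' j : ℕ, a j * ((α * j * t ^ (α * j - 1) / Real.Gamma (α * j + 1) : ℝ) : ℂ)) t := by
  have hC : 0 ≤ C := by simpa using (norm_nonneg _).trans (ha 0)
  have hu : Summable (fun j : ℕ => C * α * (t / 2)⁻¹ *
      ((2 * M * (2 * t) ^ α) ^ j / Real.Gamma (α * j + 1))) :=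
    (ml_summable hα (2 * M * (2 * t) ^ α) (by positivity)).mul_left _
  refine hasDerivAt_tsum_of_isPreconnected hu (t := Set.Ioo (t / 2) (2 * t)) isOpen_Ioo
    isPreconnected_Ioo (fun j y hy => term_deriv j (a j) (by linarith [hy.1])) ?_ (y₀ := t)
    ⟨by linarith, by linarith⟩ (F_summable hα a C M hM ha ht.le).of_norm ⟨by linarith, by linarith⟩
  intro j y hy
  have hg := gpos hα j
  have hy0 : 0 < y := by linarith [hy.1]
  rw [norm_mul, Complex.norm_real, Real.norm_of_nonneg (by positivity), Real.rpow_sub hy0,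
    Real.rpow_one, Real.rpow_mul hy0.le, Real.rpow_natCast]
  have h1 : y ^ α ≤ (2 * t) ^ α := Real.rpow_le_rpow hy0.le hy.2.le hα.le
  have h2 : y⁻¹ ≤ (t / 2)⁻¹ := inv_anti₀ (by positivity) hy.1.le
  have h3 : (j : ℝ) ≤ 2 ^ j := by exact_mod_cast Nat.lt_two_pow_self.le
  calc ‖a j‖ * (α * j * ((y ^ α) ^ j / y) / Real.Gamma (α * j + 1))
      = ‖a j‖ * (α * j * ((y ^ α) ^ j * y⁻¹) / Real.Gamma (α * j + 1)) := by rw [div_eq_mul_inv _ y]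
    _ ≤ (C * M ^ j) * (α * 2 ^ j * (((2 * t) ^ α) ^ j * (t / 2)⁻¹) / Real.Gamma (α * j + 1)) := by
        gcongr
        exact ha j
    _ = _ := by rw [mul_pow, mul_pow]; ring

lemma beta_real {p q t : ℝ} (hp : 0 < p) (hq : 0 < q) (ht : 0 < t) :
    ∫ x in (0:ℝ)..t, x ^ (p - 1) * (t - x) ^ (q - 1) =
      t ^ (p + q - 1) * (Real.Gamma p * Real.Gamma q / Real.Gamma (p + q)) := by
  have h := Complex.betaIntegral_scaled p q ht
  rw [Complex.betaIntegral_eq_Gamma_mul_div _ _ (by simpa) (by simpa)] at h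
  apply Complex.ofReal_injective
  rw [← intervalIntegral.integral_ofReal]
  push_cast
  rw [Complex.ofReal_cpow ht.le, ← Complex.Gamma_ofReal, ← Complex.Gamma_ofReal,
    ← Complex.Gamma_ofReal]
  push_cast
  rw [← h]
  apply intervalIntegral.integral_congr
  intro x hx
  rw [Set.uIcc_of_le ht.le] at hx
  simp only
  rw [Complex.ofReal_cpow hx.1, Complex.ofReal_cpow (by linarith [hx.2])]
  push_cast
  rfl

lemma beta_int {p q t : ℝ} (hp : 0 < p) (hq : 0 < q) (ht : 0 < t) :
    IntervalIntegrable (fun x => x ^ (p - 1) * (t - x) ^ (q - 1)) MeasureTheory.volume 0 t := by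
  by_contra h
  have h1 := intervalIntegral.integral_undef h
  rw [beta_real hp hq ht] at h1
  have := Real.Gamma_pos_of_pos hp
  have := Real.Gamma_pos_of_pos hq
  have := Real.Gamma_pos_of_pos (add_pos hp hq)
  have : 0 < t ^ (p + q - 1) * (Real.Gamma p * Real.Gamma q / Real.Gamma (p + q)) := by positivity
  linarith

lemma term_int {α : ℝ} (hα : 0 < α) (hα1 : α < 1) {t : ℝ} (ht : 0 < t) (j : ℕ) :
    IntervalIntegrable (fun x => α * (j + 1 : ℕ) * x ^ (α * (j + 1 : ℕ) - 1) /
      Real.Gamma (α * (j + 1 : ℕ) + 1) * (t - x) ^ (-α)) MeasureTheory.volume 0 t ∧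
    ∫ x in (0:ℝ)..t, α * (j + 1 : ℕ) * x ^ (α * (j + 1 : ℕ) - 1) /
      Real.Gamma (α * (j + 1 : ℕ) + 1) * (t - x) ^ (-α) =
      Real.Gamma (1 - α) * (t ^ (α * j) / Real.Gamma (α * j + 1)) := by
  have hp : 0 < α * (j + 1 : ℕ) := by positivity
  have hq : 0 < 1 - α := by linarith
  have e : (fun x : ℝ => α * (j + 1 : ℕ) * x ^ (α * (j + 1 : ℕ) - 1) /
      Real.Gamma (α * (j + 1 : ℕ) + 1) * (t - x) ^ (-α)) =
      fun x => (α * (j + 1 : ℕ) / Real.Gamma (α * (j + 1 : ℕ) + 1)) *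
        (x ^ (α * (j + 1 : ℕ) - 1) * (t - x) ^ ((1 - α) - 1)) := by
    funext x
    rw [show (1 - α) - 1 = -α by ring]
    ring
  constructor
  · rw [e]
    exact (beta_int hp hq ht).const_mul _
  · rw [e, intervalIntegral.integral_const_mul, beta_real hp hq ht, Real.Gamma_add_one hp.ne']
    rw [show α * ((j + 1 : ℕ):ℝ) + (1 - α) = α * j + 1 by push_cast; ring,
      show α * (j:ℝ) + 1 - 1 = α * j by ring]
    have := Real.Gamma_pos_of_pos hp
    have := gpos hα j
    field_simp

open MeasureTheory in
lemma F_caputo {α : ℝ} (hα : 0 < α) (hα1 : α < 1) (a : ℕ → ℂ) (C M : ℝ) (hM : 0 ≤ M)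
    (ha : ∀ j, ‖a j‖ ≤ C * M ^ j) (y : ℝ → ℂ)
    (hy : ∀ t, 0 < t → HasDerivAt y
      (∑' j : ℕ, a j * ((α * j * t ^ (α * j - 1) / Real.Gamma (α * j + 1) : ℝ) : ℂ)) t)
    {t : ℝ} (ht : 0 < t) :
    caputoDerivC α y t =
      ∑' j : ℕ, a (j + 1) * ((t ^ (α * j) / Real.Gamma (α * j + 1) : ℝ) : ℂ) := by
  have hG : 0 < Real.Gamma (1 - α) := Real.Gamma_pos_of_pos (by linarith)
  have ha' : ∀ j, ‖a (j + 1)‖ ≤ (C * M) * M ^ j := fun j => (ha (j + 1)).trans_eq (by ring)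
  set r : ℕ → ℝ → ℝ := fun j x => α * (j + 1 : ℕ) * x ^ (α * (j + 1 : ℕ) - 1) /
      Real.Gamma (α * (j + 1 : ℕ) + 1) * (t - x) ^ (-α) with hr
  have hrint := fun j => term_int hα hα1 ht j
  have hs0 : ∀ x, 0 < x → deriv y x =
      ∑' j : ℕ, a (j + 1) * ((α * (j + 1 : ℕ) * x ^ (α * (j + 1 : ℕ) - 1) /
        Real.Gamma (α * (j + 1 : ℕ) + 1) : ℝ) : ℂ) := by
    intro x hx
    rw [(hy x hx).deriv]
    symm
    apply Function.Injective.tsum_eq (g := Nat.succ)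
      (f := fun j : ℕ => a j * ((α * j * x ^ (α * j - 1) / Real.Gamma (α * j + 1) : ℝ) : ℂ))
      Nat.succ_injective
    intro j hj
    cases j with
    | zero => simp at hj
    | succ n => exact ⟨n, rfl⟩
  have hI : ∫ τ in (0:ℝ)..t, deriv y τ * (((t - τ) ^ (-α) : ℝ) : ℂ) =
      ∫ τ in Set.Ioc 0 t, ∑' j : ℕ, a (j + 1) * ((r j τ : ℝ) : ℂ) := by
    rw [intervalIntegral.integral_of_le ht.le]
    apply setIntegral_congr_fun measurableSet_Ioc
    intro x hx
    simp only
    rw [hs0 x hx.1, ← tsum_mul_right]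
    congr 1
    funext j
    simp only [hr]
    push_cast
    ring
  have hnorm : ∀ j, ∫ τ in Set.Ioc 0 t, ‖a (j + 1) * ((r j τ : ℝ) : ℂ)‖ =
      ‖a (j + 1)‖ * (Real.Gamma (1 - α) * (t ^ (α * j) / Real.Gamma (α * j + 1))) := by
    intro j
    rw [← (hrint j).2, intervalIntegral.integral_of_le ht.le, ← integral_const_mul]
    apply setIntegral_congr_fun measurableSet_Ioc
    intro x hx
    simp only
    rw [norm_mul, Complex.norm_real, Real.norm_of_nonneg]
    have h1 : 0 < x := hx.1
    have h2 : 0 ≤ t - x := by linarith [hx.2]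
    have := gpos hα (j + 1)
    simp only [hr]
    positivity
  have hsum := hasSum_integral_of_summable_integral_norm (μ := volume.restrict (Set.Ioc 0 t))
    (F := fun j τ => a (j + 1) * ((r j τ : ℝ) : ℂ)) (fun j => by
      apply Integrable.const_mul
      have := (intervalIntegrable_iff_integrableOn_Ioc_of_le ht.le).1 (hrint j).1
      exact this.ofReal) (by
      simp_rw [hnorm]
      refine ((F_summable hα (fun j => a (j + 1)) (C * M) M hM ha' ht.le).mul_left
        (Real.Gamma (1 - α))).congr fun j => ?_
      have := gpos hα j
      rw [norm_mul, Complex.norm_real, Real.norm_of_nonneg (by positivity)]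
      ring)
  unfold caputoDerivC
  rw [hI, ← hsum.tsum_eq, ← tsum_mul_left]
  congr 1
  funext j
  rw [integral_const_mul, ← intervalIntegral.integral_of_le ht.le, intervalIntegral.integral_ofReal]
  rw [(hrint j).2]
  push_cast
  have : (Real.Gamma (1 - α) : ℂ) ≠ 0 := by exact_mod_cast hG.ne'
  field_simp
lemma exp_eq (k : ℝ) (m : ℤ) : Complex.exp (-Complex.I * k * m) =
    Complex.exp (((-(k * m) : ℝ) : ℂ) * Complex.I) := by
  congr 1; push_cast; ring

lemma exp_norm (k : ℝ) (m : ℤ) : ‖Complex.exp (-Complex.I * k * m)‖ = 1 := by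
  rw [exp_eq, Complex.norm_exp_ofReal_mul_I]

lemma pnat_summable {s : ℝ} (hs : 1 < s) : Summable (fun d : ℕ+ => (d : ℝ) ^ (-s)) := by
  have := (Real.summable_nat_rpow (p := -s)).2 (by linarith)
  exact this.comp_injective PNat.coe_injective

lemma ls_term {s : ℝ} (d : ℕ+) (k : ℝ) :
    ‖(d : ℝ) ^ (-s) * (1 - Real.cos (d * k))‖ ≤ (d : ℝ) ^ (-s) * 2 := by
  have h0 : (0:ℝ) ≤ (d : ℝ) ^ (-s) := by positivity
  rw [norm_mul, Real.norm_of_nonneg h0]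
  gcongr
  rw [Real.norm_eq_abs, abs_le]
  constructor <;> linarith [Real.neg_one_le_cos (d * k), Real.cos_le_one (d * k)]

lemma ls_cont {s : ℝ} (hs : 1 < s) : Continuous (lsFun s) := by
  unfold lsFun
  refine continuous_const.mul (continuous_tsum (fun d => by fun_prop)
    ((pnat_summable hs).mul_right 2) fun d k => ls_term d k)

lemma ls_bound {s : ℝ} (hs : 1 < s) : ∃ M : ℝ, 0 ≤ M ∧ ∀ k, |lsFun s k| ≤ M := by
  have h := fun k => tsum_of_norm_bounded ((pnat_summable hs).mul_right 2).hasSum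
    (fun d => ls_term d k)
  refine ⟨2 * ∑' d : ℕ+, (d : ℝ) ^ (-s) * 2, by positivity, fun k => ?_⟩
  unfold lsFun
  rw [abs_mul, abs_two]
  gcongr
  exact h k

lemma ml_term {α : ℝ} (hα : 0 < α) {M t x : ℝ} (ht : 0 ≤ t) (hx : |x| ≤ M) (j : ℕ) :
    ‖(-(t ^ α) * x) ^ j / Real.Gamma (α * j + 1)‖ ≤
      (t ^ α * M) ^ j / Real.Gamma (α * j + 1) := by
  have := gpos hα j
  rw [norm_div, Real.norm_of_nonneg this.le, norm_pow, norm_mul, norm_neg,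
    Real.norm_of_nonneg (by positivity : 0 ≤ t ^ α), Real.norm_eq_abs]
  gcongr

lemma E_cont {α : ℝ} (hα : 0 < α) {M t : ℝ} (ht : 0 ≤ t) (hM : 0 ≤ M) {h : ℝ → ℝ}
    (hc : Continuous h) (hh : ∀ k, |h k| ≤ M) :
    Continuous (fun k => mittagLeffler α (-(t ^ α) * h k)) := by
  unfold mittagLeffler
  exact continuous_tsum (fun j => by fun_prop) (ml_summable hα (t ^ α * M) (by positivity))
    fun j k => ml_term hα ht (hh k) j

lemma E_bound {α : ℝ} (hα : 0 < α) {M t : ℝ} (ht : 0 ≤ t) (hM : 0 ≤ M) {h : ℝ → ℝ}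
    (hh : ∀ k, |h k| ≤ M) :
    ∃ B, 0 ≤ B ∧ ∀ k, ‖((mittagLeffler α (-(t ^ α) * h k) : ℝ) : ℂ)‖ ≤ B := by
  have H := fun k => tsum_of_norm_bounded (ml_summable hα (t ^ α * M) (by positivity)).hasSum
    (fun j => ml_term hα ht (hh k) j)
  refine ⟨_, (norm_nonneg _).trans (H 0), fun k => ?_⟩
  rw [Complex.norm_real]
  exact H k

open MeasureTheory in
lemma ml_int {α : ℝ} (hα : 0 < α) {M t B : ℝ} (ht : 0 ≤ t) (hM : 0 ≤ M) {h : ℝ → ℝ}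
    (hc : Continuous h) (hh : ∀ k, |h k| ≤ M) {φ : ℝ → ℂ} (hφ : Continuous φ)
    (hB : ∀ k, ‖φ k‖ ≤ B) :
    ∫ k in (-π)..π, φ k * ((mittagLeffler α (-(t ^ α) * h k) : ℝ) : ℂ) =
      ∑' j : ℕ, (∫ k in (-π)..π, φ k * (((-h k) ^ j : ℝ) : ℂ)) *
        ((t ^ (α * j) / Real.Gamma (α * j + 1) : ℝ) : ℂ) := by
  have hB0 : 0 ≤ B := (norm_nonneg _).trans (hB 0)
  have hS := ml_summable hα (t ^ α * M) (by positivity)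
  have key := intervalIntegral.hasSum_integral_of_dominated_convergence (μ := volume)
    (a := -π) (b := π)
    (F := fun (j : ℕ) k => φ k * (((-(t ^ α) * h k) ^ j / Real.Gamma (α * j + 1) : ℝ) : ℂ))
    (f := fun k => φ k * ((mittagLeffler α (-(t ^ α) * h k) : ℝ) : ℂ))
    (fun j _ => B * ((t ^ α * M) ^ j / Real.Gamma (α * j + 1)))
    (fun j => by
      apply Continuous.aestronglyMeasurable
      fun_prop)
    (fun j => by
      refine Filter.Eventually.of_forall fun k _ => ?_
      rw [norm_mul, Complex.norm_real]
      have := ml_term hα ht (hh k) j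
      gcongr
      exact hB k)
    (Filter.Eventually.of_forall fun k _ => hS.mul_left _)
    (by simp)
    (Filter.Eventually.of_forall fun k _ => by
      apply HasSum.mul_left
      rw [Complex.hasSum_ofReal]
      exact (Summable.of_norm_bounded hS fun j => ml_term hα ht (hh k) j).hasSum)
  rw [← key.tsum_eq]
  congr 1
  funext j
  rw [← intervalIntegral.integral_mul_const]
  congr 1
  funext k
  rw [Real.rpow_mul ht, Real.rpow_natCast, mul_assoc, ← Complex.ofReal_mul]
  congr 2
  rw [neg_mul, neg_pow, mul_pow, neg_pow (h k)]
  ring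

lemma hasSum_ls {s : ℝ} (hs : 1 < s) (k : ℝ) :
    HasSum (fun d : ℤ => (1 - Complex.exp (-Complex.I * k * d)) / (((|d| : ℤ) : ℝ) ^ s : ℝ))
      (lsFun s k : ℂ) := by
  set h : ℤ → ℂ :=
    fun d : ℤ => (1 - Complex.exp (-Complex.I * k * d)) / (((|d| : ℤ) : ℝ) ^ s : ℝ) with hh
  have hsum : Summable h := by
    refine Summable.of_norm_bounded ((Real.summable_abs_int_rpow hs).mul_left 2) fun d => ?_
    have h0 : (0:ℝ) ≤ |(d:ℝ)| := abs_nonneg _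
    simp only [hh]
    rw [norm_div, Complex.norm_real, Int.cast_abs, Real.norm_of_nonneg (by positivity),
      Real.rpow_neg h0, div_eq_mul_inv]
    gcongr
    refine (norm_sub_le _ _).trans ?_
    rw [exp_norm]; norm_num
  have h1 : Summable fun n : ℕ => h (n + 1) :=
    hsum.comp_injective (i := fun n : ℕ => (n + 1 : ℤ)) (fun a b hab => by simpa using hab)
  have h2 : Summable fun n : ℕ => h (-(n + 1)) :=
    hsum.comp_injective (i := fun n : ℕ => (-(n + 1) : ℤ)) (fun a b hab => by
      simp only at hab; omega)
  have : (lsFun s k : ℂ) = ∑' d, h d := by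
    rw [tsum_of_add_one_of_neg_add_one h1 h2]
    have h00 : h 0 = 0 := by simp [hh]
    rw [h00, add_zero, ← h1.tsum_add h2]
    unfold lsFun
    rw [tsum_pnat_eq_tsum_succ (f := fun d : ℕ => (d : ℝ) ^ (-s) * (1 - Real.cos (d * k)))]
    rw [← tsum_mul_left, Complex.ofReal_tsum]
    congr 1
    funext n
    have hn : (0:ℝ) < n + 1 := by positivity
    have e1 : ((|(n:ℤ) + 1| : ℤ) : ℝ) = n + 1 := by
      push_cast; exact abs_of_pos hn
    have e2 : ((|-((n:ℤ) + 1)| : ℤ) : ℝ) = n + 1 := by rw [abs_neg, e1]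
    simp only [hh]
    rw [e1, e2, ← add_div, div_eq_inv_mul]
    push_cast
    rw [Complex.cos]
    rw [Real.rpow_neg (by positivity)]
    rw [show -Complex.I * (k:ℂ) * (n + 1) = -((n + 1) * (k:ℂ)) * Complex.I by ring,
      show -Complex.I * (k:ℂ) * (-(n + 1)) = ((n + 1) * (k:ℂ)) * Complex.I by ring]
    push_cast
    ring
  rw [this]
  exact hsum.hasSum

lemma hasSum_ls' {s : ℝ} (hs : 1 < s) (k : ℝ) (m : ℤ) :
    HasSum (fun n : {n : ℤ // n ≠ m} =>
      (Complex.exp (-Complex.I * k * m) - Complex.exp (-Complex.I * k * (n : ℤ))) /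
        (((|m - (n : ℤ)| : ℤ) : ℝ) ^ s : ℝ))
      (Complex.exp (-Complex.I * k * m) * lsFun s k) := by
  have h1 := ((Equiv.subRight m).hasSum_iff.2 (hasSum_ls hs k)).mul_left
    (Complex.exp (-Complex.I * k * m))
  rw [← hasSum_subtype_iff_of_support_subset (s := {n : ℤ | n ≠ m})] at h1
  · convert! h1 using 1
    funext n
    simp only [Function.comp, Equiv.subRight_apply]
    rw [abs_sub_comm m, ← mul_div_assoc, mul_sub, ← Complex.exp_add, mul_one]
    congr 3
    push_cast
    ring_nf
  · intro n hn hnm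
    apply hn
    simp [hnm]

open MeasureTheory in
lemma rhs_hasSum {s α : ℝ} (hs : 1 < s) (hα : 0 < α) (m : ℤ) {t : ℝ} (ht : 0 ≤ t) :
    HasSum (fun n : {n : ℤ // n ≠ m} =>
        (fundSol α s m t - fundSol α s (n : ℤ) t) / (((|m - (n : ℤ)| : ℤ) : ℝ) ^ s : ℝ))
      ((1 / (2 * (π : ℂ))) * ∫ k in (-π)..π, (Complex.exp (-Complex.I * k * m) * lsFun s k) *
        ((mittagLeffler α (-(t ^ α) * lsFun s k) : ℝ) : ℂ)) := by
  obtain ⟨M, hM, hh⟩ := ls_bound hs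
  obtain ⟨B, hB0, hB⟩ := E_bound hα ht hM hh
  have hE := E_cont hα ht hM (ls_cont hs) hh
  have hEC : Continuous fun k => ((mittagLeffler α (-(t ^ α) * lsFun s k) : ℝ) : ℂ) :=
    Complex.continuous_ofReal.comp hE
  have hb : Summable (fun n : {n : ℤ // n ≠ m} => 2 * B * |((n - m : ℤ) : ℝ)| ^ (-s)) := by
    have := ((Equiv.subRight m).summable_iff.2 (Real.summable_abs_int_rpow hs)).mul_left (2 * B)
    exact this.comp_injective Subtype.val_injective
  have key := intervalIntegral.hasSum_integral_of_dominated_convergence (μ := volume)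
    (a := -π) (b := π)
    (F := fun (n : {n : ℤ // n ≠ m}) k =>
      (Complex.exp (-Complex.I * k * m) - Complex.exp (-Complex.I * k * (n : ℤ))) /
        (((|m - (n : ℤ)| : ℤ) : ℝ) ^ s : ℝ) *
        ((mittagLeffler α (-(t ^ α) * lsFun s k) : ℝ) : ℂ))
    (f := fun k => (Complex.exp (-Complex.I * k * m) * lsFun s k) *
        ((mittagLeffler α (-(t ^ α) * lsFun s k) : ℝ) : ℂ))
    (fun n _ => 2 * B * |((n - m : ℤ) : ℝ)| ^ (-s))
    (fun n => by
      apply Continuous.aestronglyMeasurable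
      refine Continuous.mul ?_ hEC
      fun_prop)
    (fun n => by
      refine Filter.Eventually.of_forall fun k _ => ?_
      have h0 : (0:ℝ) ≤ |((n - m : ℤ):ℝ)| := abs_nonneg _
      rw [norm_mul, norm_div, Complex.norm_real, abs_sub_comm m, Int.cast_abs,
        Real.norm_of_nonneg (by positivity), Real.rpow_neg h0, div_eq_mul_inv]
      have h2 : ‖Complex.exp (-Complex.I * k * m) - Complex.exp (-Complex.I * k * (n : ℤ))‖ ≤ 2 := by
        refine (norm_sub_le _ _).trans ?_
        rw [exp_norm, exp_norm]; norm_num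
      calc _ ≤ 2 * (|((n - m : ℤ):ℝ)| ^ s)⁻¹ * B := by
            gcongr
            exact hB k
        _ = _ := by ring)
    (Filter.Eventually.of_forall fun k _ => hb)
    (by simp)
    (Filter.Eventually.of_forall fun k _ => (hasSum_ls' hs k m).mul_right _)
  have key2 := key.mul_left (1 / (2 * (π : ℂ)))
  convert! key2 using 1
  funext n
  unfold fundSol
  rw [← mul_sub, ← intervalIntegral.integral_sub, mul_div_assoc,
    ← intervalIntegral.integral_div]
  · congr 2
    funext k
    ring
  · apply Continuous.intervalIntegrable
    refine Continuous.mul ?_ hEC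
    fun_prop
  · apply Continuous.intervalIntegrable
    refine Continuous.mul ?_ hEC
    fun_prop

lemma init_val (α s : ℝ) (hα : 0 < α) (m : ℤ) : fundSol α s m 0 = if m = 0 then 1 else 0 := by
  have hE : mittagLeffler α 0 = 1 := by
    unfold mittagLeffler
    rw [tsum_eq_single 0]
    · simp
    · intro j hj
      simp [hj]
  unfold fundSol
  simp only [Real.zero_rpow hα.ne', neg_zero, zero_mul, hE, Complex.ofReal_one, mul_one]
  have hpi : (π : ℂ) ≠ 0 := by exact_mod_cast Real.pi_ne_zero
  split_ifs with hm
  · subst hm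
    simp
    field_simp
    norm_num
  · have hc : (-Complex.I * m : ℂ) ≠ 0 := by simp [hm]
    have : ∫ k in (-π)..π, Complex.exp (-Complex.I * k * m) =
        ∫ k in (-π)..π, Complex.exp ((-Complex.I * m) * k) := by
      congr 1; funext k; congr 1; ring
    rw [this, integral_exp_mul_complex hc]
    have : Complex.exp (-Complex.I * m * π) = Complex.exp (-Complex.I * m * (-π : ℝ)) := by
      rw [Complex.exp_eq_exp_iff_exists_int]
      exact ⟨-m, by push_cast; ring⟩
    rw [this]
    simp

theorem fundSol_solves_GDE (s α : ℝ) (hs : 1 < s) (hα : 0 < α) (hα1 : α < 1) :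
    (∀ m : ℤ, fundSol α s m 0 = if m = 0 then 1 else 0) ∧
    (∀ (m : ℤ) (t : ℝ), 0 < t → DifferentiableAt ℝ (fundSol α s m) t) ∧
    (∀ (m : ℤ) (t : ℝ), 0 < t →
      Summable (fun n : {n : ℤ // n ≠ m} =>
        ‖(fundSol α s m t - fundSol α s (n : ℤ) t) /
          (((|m - (n : ℤ)| : ℤ) : ℝ) ^ s : ℝ)‖) ∧
      caputoDerivC α (fundSol α s m) t =
        -∑' n : {n : ℤ // n ≠ m},
          (fundSol α s m t - fundSol α s (n : ℤ) t) /
            (((|m - (n : ℤ)| : ℤ) : ℝ) ^ s : ℝ)) := by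
  obtain ⟨M, hM, hh⟩ := ls_bound hs
  have hlc := ls_cont hs
  set a : ℤ → ℕ → ℂ := fun m j => (1 / (2 * (π : ℂ))) *
    ∫ k in (-π)..π, Complex.exp (-Complex.I * k * m) * (((-lsFun s k) ^ j : ℝ) : ℂ) with ha
  have hab : ∀ m j, ‖a m j‖ ≤ 1 * M ^ j := by
    intro m j
    have h := intervalIntegral.norm_integral_le_of_norm_le_const (a := -π) (b := π) (C := M ^ j)
      (f := fun k : ℝ => Complex.exp (-Complex.I * k * m) * (((-lsFun s k) ^ j : ℝ) : ℂ))
      (fun k _ => by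
        rw [norm_mul, exp_norm, one_mul, Complex.norm_real, norm_pow, norm_neg, Real.norm_eq_abs]
        have := hh k
        gcongr)
    have hp := Real.pi_pos
    rw [show π - -π = 2 * π by ring, abs_of_pos (by positivity)] at h
    simp only [ha]
    rw [norm_mul, show (1 / (2 * (π:ℂ))) = ((1 / (2 * π) : ℝ) : ℂ) by push_cast; rfl,
      Complex.norm_real, Real.norm_of_nonneg (by positivity)]
    calc _ ≤ 1 / (2 * π) * (M ^ j * (2 * π)) := by gcongr
      _ = _ := by field_simp
  have hf : ∀ m t, 0 ≤ t → fundSol α s m t =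
      ∑' j : ℕ, a m j * ((t ^ (α * j) / Real.Gamma (α * j + 1) : ℝ) : ℂ) := by
    intro m t ht
    unfold fundSol
    rw [ml_int hα ht hM hlc hh (B := 1) (by fun_prop) (fun k => (exp_norm k m).le),
      ← tsum_mul_left]
    congr 1
    funext j
    simp only [ha]
    ring
  have hd : ∀ m t, 0 < t → HasDerivAt (fundSol α s m)
      (∑' j : ℕ, a m j * ((α * j * t ^ (α * j - 1) / Real.Gamma (α * j + 1) : ℝ) : ℂ)) t := by
    intro m t ht
    refine (F_deriv hα (a m) 1 M hM (hab m) ht).congr_of_eventuallyEq ?_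
    filter_upwards [lt_mem_nhds ht] with x hx
    exact hf m x hx.le
  refine ⟨init_val α s hα, fun m t ht => (hd m t ht).differentiableAt, fun m t ht => ?_⟩
  have hS := rhs_hasSum hs hα m ht.le
  refine ⟨hS.summable.norm, ?_⟩
  rw [hS.tsum_eq, F_caputo hα hα1 (a m) 1 M hM (hab m) _ (hd m) ht,
    ml_int hα ht.le hM hlc hh (B := M) (by fun_prop) (fun k => by
      rw [norm_mul, exp_norm, one_mul, Complex.norm_real]; exact hh k),
    ← tsum_mul_left, ← tsum_neg]
  congr 1
  funext j
  simp only [ha]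
  rw [← mul_assoc, ← neg_mul, ← mul_neg, ← intervalIntegral.integral_neg]
  congr 3
  funext k
  push_cast
  ring
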